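/- Let G = (V, E) be a query graph with n = |V| ≥ 2 vertices and let T be a left-deep join tree whose leaves are exactly the vertices of G and which adheres to G. Then there exists a valid edge sequence e₀, …, e_{n−2} of G whose total cost Σ_{k=0}^{n−2} κ_k equals C(T). -/

import Mathlib

open Finset

/-- A binary join tree with leaves labeled by relations in `V`. -/
inductive JoinTree (V : Type*) where
  | leaf (v : V) : JoinTree V
  | node (l r : JoinTree V) : JoinTree V

namespace JoinTree

variable {V : Type*} [DecidableEq V]

/-- The list of leaf labels of a join tree (left to right). -/
def leafList : JoinTree V → List V
  | leaf v => [v]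
  | node l r => l.leafList ++ r.leafList

/-- The finite set of leaf labels of a join tree. -/
def leaves : JoinTree V → Finset V
  | leaf v => {v}
  | node l r => l.leaves ∪ r.leaves

/-- The (estimated) cardinality of the join result of a join tree. -/
def card (c : V → ℝ) (f : Sym2 V → ℝ) : JoinTree V → ℝ
  | leaf v => c v
  | node l r =>
      (∏ i ∈ l.leaves, ∏ j ∈ r.leaves, f s(i, j)) * card c f l * card c f r

/-- The cost of a join tree: sum of the cardinalities of all intermediate results. -/
def cost (c : V → ℝ) (f : Sym2 V → ℝ) : JoinTree V → ℝ
  | leaf _ => 0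
  | node l r => card c f (node l r) + cost c f l + cost c f r

/-- A join tree is left-deep if the right child of every internal node is a leaf. -/
def IsLeftDeep : JoinTree V → Prop
  | leaf _ => True
  | node l (leaf _) => IsLeftDeep l
  | node _ (node _ _) => False

/-- A join tree adheres to the query graph `G` if every internal node joins two
subtrees connected by an edge of `G`. -/
def Adheres (G : SimpleGraph V) : JoinTree V → Prop
  | leaf _ => True
  | node l r =>
      (∃ i ∈ l.leaves, ∃ j ∈ r.leaves, G.Adj i j) ∧ Adheres G l ∧ Adheres G r

/-- The left-deep join tree with leaf labels `v 0, …, v k` from deepest to shallowest. -/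
def leftDeep (v : ℕ → V) : ℕ → JoinTree V
  | 0 => leaf (v 0)
  | k + 1 => node (leftDeep v k) (leaf (v (k + 1)))

end JoinTree

section EdgeSeq

variable {V : Type*} [DecidableEq V]

/-- The product of the selectivities over all unordered pairs of distinct vertices of `s`. -/
def pairProd (f : Sym2 V → ℝ) (s : Finset V) : ℝ :=
  ∏ p ∈ s.sym2 with ¬ p.IsDiag, f p

/-- `∏_{i ∈ s} c(i) · ∏_{{i,j} ⊆ s} f(i,j)`: the cardinality of the join of the relations in `s`. -/
def vertexProd (c : V → ℝ) (f : Sym2 V → ℝ) (s : Finset V) : ℝ :=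
  (∏ i ∈ s, c i) * pairProd f s

/-- `U k`: the union of the endpoint sets of the edges `e 0, …, e k`. -/
def endpointSet (e : ℕ → V × V) (k : ℕ) : Finset V :=
  (Finset.range (k + 1)).biUnion fun i => {(e i).1, (e i).2}

/-- A valid edge sequence of length `n - 1` for a query graph `G` on `n` vertices. -/
def ValidEdgeSeq (G : SimpleGraph V) (n : ℕ) (e : ℕ → V × V) : Prop :=
  (∀ k ≤ n - 2, G.Adj (e k).1 (e k).2) ∧
  (∀ k ≤ n - 2, (endpointSet e k).card = k + 2)

/-- The total cost `Σ_{k=0}^{n-2} κ_k` of an edge sequence. -/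
def seqCost (c : V → ℝ) (f : Sym2 V → ℝ) (n : ℕ) (e : ℕ → V × V) : ℝ :=
  ∑ k ∈ Finset.range (n - 1), vertexProd c f (endpointSet e k)

end EdgeSeq

lemma pairProd_insert {V : Type*} [DecidableEq V] (f : Sym2 V → ℝ) {s : Finset V} {v : V}
    (hv : v ∉ s) : pairProd f (insert v s) = (∏ i ∈ s, f s(i, v)) * pairProd f s := by
  have hset : {p ∈ (insert v s).sym2 | ¬ p.IsDiag} =
      s.image (fun i => s(i, v)) ∪ {p ∈ s.sym2 | ¬ p.IsDiag} := by
    ext p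
    induction p with
    | _ a b =>
      simp only [mem_filter, mk_mem_sym2_iff, mem_insert, Sym2.mk_isDiag_iff, mem_union, mem_image,
        Sym2.eq_iff]
      grind
  have hdisj : Disjoint (s.image (fun i => s(i, v))) {p ∈ s.sym2 | ¬ p.IsDiag} := by
    rw [Finset.disjoint_left]
    intro p hp hp'
    obtain ⟨i, -, rfl⟩ := mem_image.mp hp
    exact hv (mk_mem_sym2_iff.mp (mem_filter.mp hp').1).2
  unfold pairProd
  rw [hset, prod_union hdisj, prod_image fun a _ b _ h => Sym2.congr_left.mp h]

lemma pairProd_singleton {V : Type*} [DecidableEq V] (f : Sym2 V → ℝ) (v : V) :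
    pairProd f {v} = 1 := by
  simp [pairProd, Finset.filter_singleton]

lemma JoinTree.mem_leafList {V : Type*} [DecidableEq V] {T : JoinTree V} {v : V} :
    v ∈ T.leafList ↔ v ∈ T.leaves := by
  induction T with
  | leaf w => simp [leafList, leaves]
  | node l r ihl ihr => simp [leafList, leaves, ihl, ihr]

lemma JoinTree.notMem_leaves_of_nodup {V : Type*} [DecidableEq V] {l : JoinTree V} {v : V}
    (h : (node l (leaf v)).leafList.Nodup) : v ∉ l.leaves := by
  rw [← mem_leafList]
  intro hv
  exact (List.nodup_append.mp h).2.2 v hv v (by simp [leafList]) rfl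

lemma JoinTree.card_eq_vertexProd {V : Type*} [DecidableEq V] (c : V → ℝ) (f : Sym2 V → ℝ)
    {T : JoinTree V} (hld : T.IsLeftDeep) (hnodup : T.leafList.Nodup) :
    T.card c f = vertexProd c f T.leaves := by
  induction T with
  | leaf v => simp [card, leaves, vertexProd, pairProd_singleton]
  | node l r ih _ =>
    cases r with
    | node _ _ => exact hld.elim
    | leaf v =>
      have hv := notMem_leaves_of_nodup hnodup
      have hl := ih hld (List.nodup_append.mp hnodup).1
      simp only [card, leaves, prod_singleton, union_singleton, vertexProd, prod_insert hv,
        pairProd_insert f hv, hl]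
      ring

lemma endpointSet_eq {V : Type*} [DecidableEq V] {e e' : ℕ → V × V} {k : ℕ}
    (h : ∀ i ≤ k, e i = e' i) : endpointSet e k = endpointSet e' k :=
  Finset.biUnion_congr rfl fun i hi => by rw [h i (by simpa [Nat.lt_succ_iff] using hi)]

/-- The edge sequence of a left-deep tree. Adjoining any leaf to the endpoints of its edges yields
all leaves; this phrasing also covers the one-leaf tree, which has no edges. -/
lemma JoinTree.exists_edgeSeq {V : Type*} [DecidableEq V] (G : SimpleGraph V)
    (c : V → ℝ) (f : Sym2 V → ℝ) {T : JoinTree V} (hld : T.IsLeftDeep)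
    (hnodup : T.leafList.Nodup) (hadh : T.Adheres G) :
    ∃ (e : ℕ → V × V) (m : ℕ), T.leaves.card = m + 1 ∧
      (∀ k < m, G.Adj (e k).1 (e k).2 ∧ (endpointSet e k).card = k + 2) ∧
      (∀ i ∈ T.leaves, insert i ((range m).biUnion fun j => {(e j).1, (e j).2}) = T.leaves) ∧
      ∑ k ∈ range m, vertexProd c f (endpointSet e k) = T.cost c f := by
  induction T with
  | leaf v => exact ⟨fun _ => (v, v), 0, by simp [leaves, cost]⟩
  | node l r ih _ =>
    cases r with
    | node _ _ => exact hld.elim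
    | leaf v =>
      obtain ⟨⟨i, hi, j, hj, hij⟩, hadhl, -⟩ := hadh
      obtain rfl : j = v := by simpa [leaves] using hj
      have hv := notMem_leaves_of_nodup hnodup
      obtain ⟨e, m, hcard, hval, hins, hsum⟩ :=
        ih hld (List.nodup_append.mp hnodup).1 hadhl
      set e' := Function.update e m (i, j) with he'
      have hlt : ∀ k < m, e' k = e k := fun k hk => Function.update_of_ne hk.ne _ _
      have hm : e' m = (i, j) := Function.update_self ..
      have hend : ∀ k < m, endpointSet e' k = endpointSet e k := fun k hk =>
        endpointSet_eq fun a ha => hlt a (ha.trans_lt hk)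
      have hleaves : (node l (leaf j)).leaves = insert j l.leaves := by simp [leaves]
      have hlast : endpointSet e' m = insert j l.leaves := by
        have hB : ((range m).biUnion fun a => {(e' a).1, (e' a).2}) =
            (range m).biUnion fun a => {(e a).1, (e a).2} :=
          Finset.biUnion_congr rfl fun a ha => by rw [hlt a (mem_range.mp ha)]
        rw [endpointSet, range_add_one, biUnion_insert, hB, hm, ← hins i hi]
        ext x
        simp only [mem_union, mem_insert, mem_singleton]
        tauto
      have hcard' : (insert j l.leaves).card = m + 2 := by
        rw [card_insert_of_notMem hv, hcard]
      refine ⟨e', m + 1, by rw [hleaves, hcard'], fun k hk => ?_, fun a ha => ?_, ?_⟩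
      · rcases Nat.lt_succ_iff_lt_or_eq.mp hk with hk | rfl
        · rw [hend k hk, hlt k hk]
          exact hval k hk
        · rw [hlast, hm]
          exact ⟨hij, hcard'⟩
      · rw [hleaves] at ha ⊢
        change insert a (endpointSet e' m) = _
        rw [hlast, insert_eq_of_mem ha]
      · rw [sum_range_succ, sum_congr rfl fun k hk => by rw [hend k (mem_range.mp hk)], hsum, hlast,
          cost, card_eq_vertexProd c f hld hnodup, hleaves]
        simp [cost, add_comm]

/-- For every left-deep join tree `T` whose leaves are exactly the
vertices of the query graph `G` and which adheres to `G`, there is a valid edge sequence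
of `G` whose total cost `Σ_{k=0}^{n-2} κ_k` equals `C(T)`. -/
theorem exists_validEdgeSeq_of_leftDeep
    {V : Type*} [Fintype V] [DecidableEq V] (G : SimpleGraph V)
    (c : V → ℝ) (f : Sym2 V → ℝ)
    (hc : ∀ v, 0 < c v)
    (hf : ∀ p : Sym2 V, ¬ p.IsDiag → 0 < f p ∧ f p ≤ 1)
    (hf1 : ∀ p : Sym2 V, ¬ p.IsDiag → p ∉ G.edgeSet → f p = 1)
    (n : ℕ) (hn : n = Fintype.card V) (hn2 : 2 ≤ n)
    (T : JoinTree V) (hnodup : T.leafList.Nodup) (hall : T.leaves = Finset.univ)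
    (hld : T.IsLeftDeep) (hadh : T.Adheres G) :
    ∃ e : ℕ → V × V, ValidEdgeSeq G n e ∧ seqCost c f n e = T.cost c f := by
  obtain ⟨e, m, hcard, hval, -, hsum⟩ := JoinTree.exists_edgeSeq G c f hld hnodup hadh
  obtain rfl : n = m + 1 := by rw [hn, ← hcard, hall, card_univ]
  exact ⟨e, ⟨fun k hk => (hval k (by omega)).1, fun k hk => (hval k (by omega)).2⟩, hsum⟩
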